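/- Let G be a finite simple connected graph on n vertices with minimum degree δ ≥ 3, and let M be a maximum matching of G. Then every edge 2-coloring of G uses at most |M| + (n + 2|M|)/(δ − 1) colors; equivalently, if c is the number of colors of an edge 2-coloring of G, then (c − |M|)·(δ − 1) ≤ n + 2|M|. -/

import Mathlib

open SimpleGraph

/-- `C` is an edge 2-coloring of `G`: for every vertex, the edges incident to it
carry at most 2 distinct colors. -/
def IsEdge2Coloring {V : Type*} (G : SimpleGraph V) (C : Sym2 V → ℕ) : Prop :=
  ∀ v : V, (C '' G.incidenceSet v).ncard ≤ 2

/-- The number of distinct colors used by a coloring `C` on the edges of `G`. -/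
noncomputable def numColors {V : Type*} (G : SimpleGraph V) (C : Sym2 V → ℕ) : ℕ :=
  (C '' G.edgeSet).ncard

/-- `OPT G`: the maximum number of colors used by an edge 2-coloring of `G`. -/
noncomputable def OPT {V : Type*} (G : SimpleGraph V) : ℕ :=
  sSup {n : ℕ | ∃ C : Sym2 V → ℕ, IsEdge2Coloring G C ∧ numColors G C = n}

/-- `M` is a matching of `G`, given as a set of edges: the edges belong to `G` and
are pairwise vertex-disjoint. -/
def IsMatchingSet {V : Type*} (G : SimpleGraph V) (M : Set (Sym2 V)) : Prop :=
  M ⊆ G.edgeSet ∧ ∀ e ∈ M, ∀ f ∈ M, e ≠ f → ∀ v : V, v ∈ e → v ∉ f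

/-- `ALG G M`: number of colors produced by the matching based algorithm, i.e.
`|M|` plus the number of connected components of `G − M`. -/
noncomputable def ALG {V : Type*} (G : SimpleGraph V) (M : Set (Sym2 V)) : ℕ :=
  M.ncard + Nat.card (G.deleteEdges M).ConnectedComponent

/-- `H` is a characteristic subgraph of `G` with respect to the coloring `C`:
a subgraph of `G` containing exactly one edge of each color used by `C`. -/
def IsCharSubgraph {V : Type*} (G : SimpleGraph V) (C : Sym2 V → ℕ)
    (H : SimpleGraph V) : Prop :=
  H ≤ G ∧ ∀ c ∈ C '' G.edgeSet, ∃! e, e ∈ H.edgeSet ∧ C e = c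

section Coloring

open Finset Classical

variable {V : Type*} [Fintype V]

/-- The colors on the edges incident to `v`. -/
noncomputable def colorsAt (G : SimpleGraph V) (C : Sym2 V → ℕ) (v : V) : Finset ℕ :=
  (univ.filter (G.Adj v)).image fun w => C s(v, w)

/-- The number of vertices of `A` that see the color `c`. -/
noncomputable def colorMult (G : SimpleGraph V) (C : Sym2 V → ℕ) (A : Finset V) (c : ℕ) : ℕ :=
  #{v ∈ A | c ∈ colorsAt G C v}

/-- The charge sent by a vertex `v` of `S` to each of its neighbors outside `S`. -/
noncomputable def demand (G : SimpleGraph V) (C : Sym2 V → ℕ) (δ : ℕ) (S : Finset V) (v : V) : ℚ :=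
  if 3 * (∏ c ∈ colorsAt G C v, colorMult G C S c) + 1 < δ then
    1 / ((∏ c ∈ colorsAt G C v, colorMult G C S c : ℕ) : ℚ) else 0

variable {G : SimpleGraph V} {C : Sym2 V → ℕ} {A S : Finset V} {δ : ℕ}

lemma mem_colorsAt {v : V} {c : ℕ} : c ∈ colorsAt G C v ↔ ∃ w, G.Adj v w ∧ C s(v, w) = c := by
  simp [colorsAt]

lemma color_mem_colorsAt_left {v w : V} (h : G.Adj v w) : C s(v, w) ∈ colorsAt G C v :=
  mem_colorsAt.2 ⟨w, h, rfl⟩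

lemma color_mem_colorsAt_right {v w : V} (h : G.Adj v w) : C s(v, w) ∈ colorsAt G C w :=
  mem_colorsAt.2 ⟨v, h.symm, by rw [Sym2.eq_swap]⟩

lemma card_colorsAt_le_two (hC : IsEdge2Coloring G C) (v : V) : #(colorsAt G C v) ≤ 2 := by
  have h := hC v
  have : C '' G.incidenceSet v = (colorsAt G C v : Set ℕ) := by
    ext c
    simp only [Set.mem_image, mem_coe, mem_colorsAt]
    constructor
    · rintro ⟨e, ⟨he, hv⟩, rfl⟩
      obtain ⟨w, rfl⟩ := Sym2.mem_iff_exists.1 hv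
      exact ⟨w, he, rfl⟩
    · rintro ⟨w, hw, rfl⟩
      exact ⟨s(v, w), ⟨hw, by simp⟩, rfl⟩
  rwa [this, Set.ncard_coe_finset] at h

lemma numColors_eq_card_biUnion (G : SimpleGraph V) (C : Sym2 V → ℕ) :
    numColors G C = #(univ.biUnion (colorsAt G C)) := by
  rw [numColors, ← Set.ncard_coe_finset]
  congr 1
  ext c
  simp only [Set.mem_image, mem_coe, mem_biUnion, mem_univ, true_and, mem_colorsAt]
  constructor
  · rintro ⟨e, he, rfl⟩
    induction e with
    | _ v w => exact ⟨v, w, he, rfl⟩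
  · rintro ⟨v, w, hw, rfl⟩
    exact ⟨s(v, w), hw, rfl⟩

lemma colorMult_pos {v : V} {c : ℕ} (hv : v ∈ A) (hc : c ∈ colorsAt G C v) :
    0 < colorMult G C A c :=
  card_pos.2 ⟨v, mem_filter.2 ⟨hv, hc⟩⟩

lemma colorMult_erase {v : V} {c : ℕ} (hv : v ∈ A) (hc : c ∈ colorsAt G C v) :
    colorMult G C (A.erase v) c + 1 = colorMult G C A c := by
  rw [colorMult, filter_erase, card_erase_add_one (mem_filter.2 ⟨hv, hc⟩), colorMult]

lemma card_neighbors_le (v : V) (A : Finset V) :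
    #{w ∈ A | G.Adj v w} ≤ ∑ c ∈ colorsAt G C v, colorMult G C (A.erase v) c := by
  refine le_trans (card_le_card ?_) card_biUnion_le
  intro w hw
  rw [mem_filter] at hw
  simp only [mem_biUnion, mem_filter, mem_erase]
  exact ⟨_, color_mem_colorsAt_left hw.2, ⟨hw.2.ne', hw.1⟩, color_mem_colorsAt_right hw.2⟩

lemma sum_card_colorsAt_inter (A : Finset V) (T : Finset ℕ) :
    ∑ v ∈ A, #(colorsAt G C v ∩ T) = ∑ c ∈ T, colorMult G C A c := by
  have h := sum_card_bipartiteAbove_eq_sum_card_bipartiteBelow (s := A) (t := T)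
    fun v c => c ∈ colorsAt G C v
  simpa only [bipartiteAbove, bipartiteBelow, filter_mem_eq_inter, inter_comm T] using! h

lemma card_eq_sum_inv_colorMult (A : Finset V) (T : Finset ℕ)
    (hT : ∀ c ∈ T, ∃ v ∈ A, c ∈ colorsAt G C v) :
    (#T : ℚ) = ∑ v ∈ A, ∑ c ∈ colorsAt G C v ∩ T, (1 : ℚ) / colorMult G C A c := by
  rw [sum_comm' (t' := T) (s' := fun c => {v ∈ A | c ∈ colorsAt G C v})
    (by intro v c; simp only [mem_inter, mem_filter]; tauto)]
  rw [card_eq_sum_ones, Nat.cast_sum]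
  refine sum_congr rfl fun c hc => ?_
  obtain ⟨v, hv, hvc⟩ := hT c hc
  have := colorMult_pos hv hvc
  rw [sum_const, nsmul_eq_mul, ← colorMult, Nat.cast_one, mul_one_div_cancel (by positivity)]

lemma demand_nonneg (v : V) : 0 ≤ demand G C δ S v := by
  unfold demand
  split_ifs <;> positivity

lemma demand_le {v : V} {c : ℕ} (hv : v ∈ S) (hc : c ∈ colorsAt G C v) :
    demand G C δ S v ≤
      if 3 * colorMult G C S c + 1 < δ then 1 / (colorMult G C S c : ℚ) else 0 := by
  have hle : colorMult G C S c ≤ ∏ c ∈ colorsAt G C v, colorMult G C S c :=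
    Nat.le_of_dvd (prod_pos fun d hd => colorMult_pos hv hd) (dvd_prod_of_mem _ hc)
  have hpos := colorMult_pos hv hc
  unfold demand
  split_ifs
  · gcongr
  · omega
  · positivity
  · rfl

lemma sum_demand_color_le (c : ℕ) :
    ∑ v ∈ S with c ∈ colorsAt G C v, demand G C δ S v ≤
      if 3 * colorMult G C S c + 1 < δ then 1 else 0 := by
  refine (sum_le_card_nsmul _ _ _ fun v hv =>
    demand_le (mem_filter.1 hv).1 (mem_filter.1 hv).2).trans ?_
  rw [← colorMult, nsmul_eq_mul]
  split_ifs
  · rw [mul_one_div]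
    exact div_self_le_one _
  · simp

/-- The charge that a vertex receives from `S` is at most the number of its colors of small
multiplicity in `S`. -/
lemma sum_demand_neighbors_le (w : V) :
    ∑ v ∈ S with G.Adj w v, demand G C δ S v ≤
      #{c ∈ colorsAt G C w ∩ S.biUnion (colorsAt G C) | 3 * colorMult G C S c + 1 < δ} := by
  have hmaps : ∀ v ∈ S, G.Adj w v → C s(w, v) ∈ colorsAt G C w ∩ S.biUnion (colorsAt G C) :=
    fun v hv h => mem_inter.2 ⟨color_mem_colorsAt_left h,
      mem_biUnion.2 ⟨v, hv, color_mem_colorsAt_right h⟩⟩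
  rw [← sum_fiberwise_of_maps_to fun v hv => hmaps v (mem_filter.1 hv).1 (mem_filter.1 hv).2]
  have hsub : ∀ c, ({v ∈ ({v ∈ S | G.Adj w v} : Finset V) | C s(w, v) = c}) ⊆
      {v ∈ S | c ∈ colorsAt G C v} := by
    intro c v hv
    simp only [mem_filter] at hv ⊢
    exact ⟨hv.1.1, hv.2 ▸ color_mem_colorsAt_right hv.1.2⟩
  refine (sum_le_sum fun c _ => (sum_le_sum_of_subset_of_nonneg (hsub c) fun v _ _ =>
    demand_nonneg v).trans (sum_demand_color_le c)).trans ?_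
  simp

lemma sum_demand_neighbors_le_card (w : V) :
    ∑ v ∈ S with G.Adj w v, demand G C δ S v ≤
      #(colorsAt G C w ∩ S.biUnion (colorsAt G C)) :=
  (sum_demand_neighbors_le w).trans (by exact_mod_cast card_filter_le _ _)

lemma sum_demand_neighbors_le_one (hC : IsEdge2Coloring G C)
    (hδ : ∀ v, δ ≤ #{w | G.Adj v w}) {w : V} (hw : ∀ v, G.Adj w v → v ∈ S) :
    ∑ v ∈ S with G.Adj w v, demand G C δ S v ≤ 1 := by
  refine (sum_demand_neighbors_le w).trans ?_
  by_contra! hlt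
  have hlt : 1 < #{c ∈ colorsAt G C w ∩ S.biUnion (colorsAt G C) |
    3 * colorMult G C S c + 1 < δ} := by exact_mod_cast hlt
  obtain ⟨a, ha, b, hb, hab⟩ := one_lt_card.1 hlt
  simp only [mem_filter, mem_inter] at ha hb
  have hcol : colorsAt G C w = {a, b} := (eq_of_subset_of_card_le (by
    intro x; simp only [mem_insert, mem_singleton]; rintro (rfl | rfl)
    exacts [ha.1.1, hb.1.1]) (by rw [card_pair hab]; exact card_colorsAt_le_two hC w)).symm
  have h1 : #{v | G.Adj w v} ≤ #{v ∈ S | G.Adj w v} :=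
    card_le_card fun v hv => by
      have hv := (mem_filter.1 hv).2
      exact mem_filter.2 ⟨hw v hv, hv⟩
  have h2 := card_neighbors_le (C := C) (G := G) w S
  rw [hcol, sum_pair hab] at h2
  have h3 : ∀ c, colorMult G C (S.erase w) c ≤ colorMult G C S c := fun c =>
    card_le_card (filter_subset_filter _ (erase_subset _ _))
  have := hδ w
  have := h3 a
  have := h3 b
  omega

/-- A vertex of `S` pays for its share of the colors seen by `S`. -/
lemma sum_inv_colorMult_le (hC : IsEdge2Coloring G C) (hδ3 : 3 ≤ δ)
    (hδ : ∀ v, δ ≤ #{w | G.Adj v w}) {v : V} (hv : v ∈ S) :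
    ((δ : ℚ) - 1) * ∑ c ∈ colorsAt G C v, (1 : ℚ) / colorMult G C S c ≤
      (δ + 2) + #{w ∈ Sᶜ | G.Adj v w} * demand G C δ S v := by
  have hδ3' : (3 : ℚ) ≤ δ := by exact_mod_cast hδ3
  have hd := demand_nonneg (G := G) (C := C) (δ := δ) (S := S) v
  suffices h : ∑ c ∈ colorsAt G C v, (1 : ℚ) / colorMult G C S c ≤ 1 ∨
      ((δ : ℚ) - 1) * ∑ c ∈ colorsAt G C v, (1 : ℚ) / colorMult G C S c ≤
      (δ + 2) + #{w ∈ Sᶜ | G.Adj v w} * demand G C δ S v by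
    rcases h with h | h
    · have : ((δ : ℚ) - 1) * ∑ c ∈ colorsAt G C v, (1 : ℚ) / colorMult G C S c ≤ (δ - 1) * 1 := by
        gcongr; linarith
      have : 0 ≤ #{w ∈ Sᶜ | G.Adj v w} * demand G C δ S v := by positivity
      linarith
    · exact h
  have hone : ∀ c ∈ colorsAt G C v, (1 : ℚ) / colorMult G C S c ≤ 1 := fun c hc => by
    have : (1 : ℚ) ≤ colorMult G C S c := by exact_mod_cast colorMult_pos hv hc
    exact div_le_one_of_le₀ this (by positivity)
  rcases (card_colorsAt_le_two hC v).lt_or_eq with hlt | heq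
  · left
    calc _ ≤ #(colorsAt G C v) • (1 : ℚ) := sum_le_card_nsmul _ _ _ hone
      _ ≤ 1 := by rw [nsmul_one]; exact_mod_cast Nat.lt_succ_iff.1 hlt
  obtain ⟨a, b, hab, hcol⟩ := card_eq_two.1 heq
  have ha : a ∈ colorsAt G C v := by simp [hcol]
  have hb : b ∈ colorsAt G C v := by simp [hcol]
  wlog hle : colorMult G C S a ≤ colorMult G C S b generalizing a b
  · exact this b a hab.symm (by rw [hcol, pair_comm]) hb ha (le_of_not_ge hle)
  have hpa := colorMult_pos hv ha
  rcases (Nat.succ_le_of_lt hpa).lt_or_eq with h2 | h1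
  · left
    rw [hcol, sum_pair hab]
    have h2a : (2 : ℚ) ≤ colorMult G C S a := by exact_mod_cast Nat.succ_le_of_lt h2
    have h2b : (2 : ℚ) ≤ colorMult G C S b := by exact_mod_cast Nat.succ_le_of_lt (h2.trans_le hle)
    have := one_div_le_one_div_of_le (by norm_num) h2a
    have := one_div_le_one_div_of_le (by norm_num) h2b
    linarith
  right
  have hnb := card_neighbors_le (C := C) (G := G) v S
  have hea := colorMult_erase hv ha
  have heb := colorMult_erase hv hb
  have hpb := colorMult_pos hv hb
  rw [hcol, sum_pair hab] at hnb ⊢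
  have hsplit : #{w | G.Adj v w} = #{w ∈ S | G.Adj v w} + #{w ∈ Sᶜ | G.Adj v w} := by
    rw [← card_union_of_disjoint (disjoint_filter_filter disjoint_compl_right), ← filter_union,
      union_compl]
  have hdeg := hδ v
  have hout : δ + 1 ≤ #{w ∈ Sᶜ | G.Adj v w} + colorMult G C S b := by omega
  have hpb' : (0 : ℚ) < colorMult G C S b := by exact_mod_cast hpb
  unfold demand
  rw [hcol, prod_pair hab, ← h1]
  simp only [Nat.succ_eq_add_one, zero_add, one_mul, Nat.cast_one, div_one]
  split_ifs with hif
  · have hout' : (δ : ℚ) + 1 - colorMult G C S b ≤ #{w ∈ Sᶜ | G.Adj v w} := by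
      have : (δ : ℚ) + 1 ≤ #{w ∈ Sᶜ | G.Adj v w} + colorMult G C S b := by exact_mod_cast hout
      linarith
    have key : ((δ : ℚ) + 1 - colorMult G C S b) * (1 / colorMult G C S b) ≤
      #{w ∈ Sᶜ | G.Adj v w} * (1 / (colorMult G C S b : ℚ)) := by gcongr
    have h3 : (colorMult G C S b : ℚ) * (1 / colorMult G C S b) = 1 :=
      mul_one_div_cancel hpb'.ne'
    have : (0 : ℚ) ≤ 1 / colorMult G C S b := by positivity
    linarith
  · have hif' : (δ : ℚ) ≤ 3 * colorMult G C S b + 1 := by exact_mod_cast not_lt.1 hif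
    have : ((δ : ℚ) - 1) * (1 / colorMult G C S b) ≤ 3 := by
      rw [mul_one_div, div_le_iff₀ hpb']
      linarith
    linarith

/-- The colors seen by `S` are bounded by a charge on `S` and a charge on its complement. -/
lemma card_colors_of_finset_le (hC : IsEdge2Coloring G C) (hδ3 : 3 ≤ δ)
    (hδ : ∀ v, δ ≤ #{w | G.Adj v w}) (S : Finset V) :
    ((δ : ℚ) - 1) * #(S.biUnion (colorsAt G C)) ≤
      (δ + 2) * #S + ∑ w ∈ Sᶜ, ∑ v ∈ S with G.Adj w v, demand G C δ S v := by
  rw [card_eq_sum_inv_colorMult S _ fun c hc => mem_biUnion.1 hc, mul_sum]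
  have hswap : ∑ w ∈ Sᶜ, ∑ v ∈ S with G.Adj w v, demand G C δ S v =
      ∑ v ∈ S, #{w ∈ Sᶜ | G.Adj v w} * demand G C δ S v := by
    rw [sum_comm' (t' := S) (s' := fun v => {w ∈ Sᶜ | G.Adj v w})
      (by intro w v; simp only [mem_filter, G.adj_comm w v]; tauto)]
    simp
  rw [hswap, mul_comm _ (#S : ℚ), ← nsmul_eq_mul, ← sum_const, ← sum_add_distrib]
  refine sum_le_sum fun v hv => ?_
  rw [inter_eq_left.2 (subset_biUnion_of_mem (colorsAt G C) hv)]
  exact sum_inv_colorMult_le hC hδ3 hδ hv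

/-- If both colors of `w` avoid `S`, then the neighborhood of `w` is contained in its part. -/
lemma inv_colorMult_le_of_card_eq_two (hC : IsEdge2Coloring G C)
    (hδ : ∀ v, δ ≤ #{w | G.Adj v w}) {K : Finset V}
    (hK : ∀ w ∈ K, ∀ v, G.Adj w v → v ∈ S ∨ v ∈ K) {w : V} (hw : w ∈ K)
    (h2 : #(colorsAt G C w \ S.biUnion (colorsAt G C)) = 2) :
    δ + 1 ≤ #K ∧ ((δ : ℚ) - 1) * ∑ c ∈ colorsAt G C w \ S.biUnion (colorsAt G C),
      (1 : ℚ) / colorMult G C K c ≤ (δ + 1) / 2 := by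
  have heq : colorsAt G C w \ S.biUnion (colorsAt G C) = colorsAt G C w :=
    eq_of_subset_of_card_le sdiff_subset (by rw [h2]; exact card_colorsAt_le_two hC w)
  have hnbr : ∀ v, G.Adj w v → v ∈ K := fun v hv => (hK w hw v hv).resolve_left fun hvS => by
    have h := color_mem_colorsAt_left (C := C) hv
    rw [← heq, mem_sdiff] at h
    exact h.2 (mem_biUnion.2 ⟨v, hvS, color_mem_colorsAt_right hv⟩)
  have hdeg : δ ≤ #{v ∈ K | G.Adj w v} := (hδ w).trans (card_le_card fun v hv => by
    have hv := (mem_filter.1 hv).2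
    exact mem_filter.2 ⟨hnbr v hv, hv⟩)
  constructor
  · have hsub : #{v ∈ K | G.Adj w v} ≤ #(K.erase w) := card_le_card fun v hv => by
      rw [mem_filter] at hv
      exact mem_erase.2 ⟨hv.2.ne', hv.1⟩
    have := card_erase_add_one hw
    omega
  rw [heq] at h2 ⊢
  obtain ⟨a, b, hab, hcol⟩ := card_eq_two.1 h2
  have htwo : ∀ c ∈ colorsAt G C w, (2 : ℚ) ≤ colorMult G C K c := fun c hc => by
    obtain ⟨v, hv, rfl⟩ := mem_colorsAt.1 hc
    have := colorMult_pos (mem_erase.2 ⟨hv.ne', hnbr v hv⟩) (color_mem_colorsAt_right (C := C) hv)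
    have := colorMult_erase hw hc
    exact_mod_cast (by omega : 2 ≤ colorMult G C K (C s(w, v)))
  have ha := htwo a (by simp [hcol])
  have hb := htwo b (by simp [hcol])
  have hnb := card_neighbors_le (C := C) (G := G) w K
  have hea := colorMult_erase hw (show a ∈ colorsAt G C w by simp [hcol])
  have heb := colorMult_erase hw (show b ∈ colorsAt G C w by simp [hcol])
  rw [hcol, sum_pair hab] at hnb ⊢
  have hsum : (δ : ℚ) + 2 ≤ colorMult G C K a + colorMult G C K b := by
    exact_mod_cast (by omega : δ + 2 ≤ colorMult G C K a + colorMult G C K b)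
  generalize (colorMult G C K a : ℚ) = x at *
  generalize (colorMult G C K b : ℚ) = y at *
  have hx : x ≠ 0 := by linarith
  have hy : y ≠ 0 := by linarith
  have hδ0 : (0 : ℚ) ≤ δ := by positivity
  rw [one_div_add_one_div hx hy, ← mul_div_assoc, div_le_div_iff₀ (by positivity) (by norm_num)]
  nlinarith [mul_nonneg (sub_nonneg.2 ha) (sub_nonneg.2 hb)]

/-- Two vertices of `K` see each color occurring in `K` but not on `S`. -/
lemma two_le_colorMult {K : Finset V} (hK : ∀ w ∈ K, ∀ v, G.Adj w v → v ∈ S ∨ v ∈ K) {c : ℕ}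
    (hc : c ∈ K.biUnion (colorsAt G C) \ S.biUnion (colorsAt G C)) :
    2 ≤ colorMult G C K c := by
  obtain ⟨hcK, hcS⟩ := mem_sdiff.1 hc
  obtain ⟨w, hw, hcw⟩ := mem_biUnion.1 hcK
  obtain ⟨v, hv, rfl⟩ := mem_colorsAt.1 hcw
  have hvK : v ∈ K := (hK w hw v hv).resolve_left fun hvS =>
    hcS (mem_biUnion.2 ⟨v, hvS, color_mem_colorsAt_right hv⟩)
  have := colorMult_pos (mem_erase.2 ⟨hv.ne', hvK⟩) (color_mem_colorsAt_right (C := C) hv)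
  have := colorMult_erase hw hcw
  omega

/-- A part of the complement of `S` pays for the colors that occur only inside it and for the
charge it sends to `S`. -/
lemma card_colors_of_part_le (hC : IsEdge2Coloring G C) (hδ3 : 3 ≤ δ)
    (hδ : ∀ v, δ ≤ #{w | G.Adj v w}) {K : Finset V}
    (hK : ∀ w ∈ K, ∀ v, G.Adj w v → v ∈ S ∨ v ∈ K) :
    ((δ : ℚ) - 1) * #(K.biUnion (colorsAt G C) \ S.biUnion (colorsAt G C)) +
      ∑ w ∈ K, ∑ v ∈ S with G.Adj w v, demand G C δ S v ≤
      #K + (δ + 1) * (#K / 2 : ℕ) := by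
  have hδ3' : (3 : ℚ) ≤ δ := by exact_mod_cast hδ3
  set T := K.biUnion (colorsAt G C) \ S.biUnion (colorsAt G C) with hT
  have hinter : ∀ w ∈ K, colorsAt G C w ∩ T = colorsAt G C w \ S.biUnion (colorsAt G C) := by
    intro w hw
    rw [hT, ← inter_sdiff_assoc, inter_eq_left.2 (subset_biUnion_of_mem (colorsAt G C) hw)]
  have hcharge : ∀ w ∈ K, ∑ v ∈ S with G.Adj w v, demand G C δ S v ≤
      2 - (#(colorsAt G C w ∩ T) : ℚ) := by
    intro w hw
    refine (sum_demand_neighbors_le_card w).trans ?_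
    have h1 := card_sdiff_add_card_inter (colorsAt G C w) (S.biUnion (colorsAt G C))
    have h2 := card_colorsAt_le_two hC w
    rw [← h1, ← hinter w hw] at h2
    rw [le_sub_iff_add_le']
    exact_mod_cast h2
  have hI : 2 * #T ≤ ∑ w ∈ K, #(colorsAt G C w ∩ T) := by
    rw [sum_card_colorsAt_inter, mul_comm, ← smul_eq_mul]
    exact card_nsmul_le_sum _ _ _ fun c hc => two_le_colorMult hK hc
  have hsum : ∑ w ∈ K, ∑ v ∈ S with G.Adj w v, demand G C δ S v ≤
      2 * #K - ((∑ w ∈ K, #(colorsAt G C w ∩ T) : ℕ) : ℚ) := by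
    refine (sum_le_sum hcharge).trans_eq ?_
    rw [sum_sub_distrib, sum_const, nsmul_eq_mul, mul_comm, Nat.cast_sum]
  by_cases hle : ∑ w ∈ K, #(colorsAt G C w ∩ T) ≤ #K
  · rcases Nat.lt_or_ge #K 2 with hlt | hge
    · have hT0 : #T = 0 := by omega
      rw [hT0, Nat.div_eq_of_lt hlt]
      simp only [Nat.cast_zero, mul_zero, zero_add, add_zero]
      have hone : ∀ w ∈ K, ∑ v ∈ S with G.Adj w v, demand G C δ S v ≤ 1 := fun w hw =>
        sum_demand_neighbors_le_one hC hδ fun v hv => (hK w hw v hv).resolve_right fun hvK =>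
          hv.ne (card_le_one.1 (Nat.lt_succ_iff.1 hlt) w hw v hvK)
      simpa using sum_le_card_nsmul _ _ _ hone
    · have h1 : (2 : ℚ) * #T ≤ (∑ w ∈ K, #(colorsAt G C w ∩ T) : ℕ) := by exact_mod_cast hI
      have h2 : (#T : ℚ) ≤ (#K / 2 : ℕ) := by
        exact_mod_cast (by omega : #T ≤ #K / 2)
      have h3 : (#K : ℚ) ≤ 4 * (#K / 2 : ℕ) := by
        exact_mod_cast (by omega : #K ≤ 4 * (#K / 2))
      nlinarith [mul_le_mul_of_nonneg_left h2 (by linarith : (0 : ℚ) ≤ δ - 3)]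
  · push Not at hle
    obtain ⟨w₀, hw₀, hlt⟩ : ∃ w ∈ K, 1 < #(colorsAt G C w ∩ T) := by
      by_contra! h
      exact hle.not_ge (by simpa using sum_le_card_nsmul _ _ _ h)
    have hbound : ∀ w ∈ K, #(colorsAt G C w ∩ T) ≤ 2 := fun w _ =>
      (card_le_card inter_subset_left).trans (card_colorsAt_le_two hC w)
    have hbig : δ + 1 ≤ #K := (inv_colorMult_le_of_card_eq_two hC hδ hK hw₀
      (by rw [← hinter w₀ hw₀]; exact (hbound w₀ hw₀).antisymm hlt)).1
    have hvert : ∀ w ∈ K, ((δ : ℚ) - 1) * ∑ c ∈ colorsAt G C w ∩ T,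
        (1 : ℚ) / colorMult G C K c + (2 - (#(colorsAt G C w ∩ T) : ℚ)) ≤ (δ + 1) / 2 := by
      intro w hw
      rcases (hbound w hw).lt_or_eq with hw2 | hw2
      · have hhalf : ∀ c ∈ colorsAt G C w ∩ T, (1 : ℚ) / colorMult G C K c ≤ 1 / 2 :=
          fun c hc => one_div_le_one_div_of_le (by norm_num)
            (by exact_mod_cast two_le_colorMult hK (mem_inter.1 hc).2)
        have h1 := sum_le_card_nsmul _ _ _ hhalf
        rw [nsmul_eq_mul] at h1
        have h2 : (#(colorsAt G C w ∩ T) : ℚ) ≤ 1 := by exact_mod_cast Nat.lt_succ_iff.1 hw2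
        nlinarith [mul_le_mul_of_nonneg_left h1 (by linarith : (0 : ℚ) ≤ δ - 1),
          mul_le_mul_of_nonneg_left h2 (by linarith : (0 : ℚ) ≤ δ - 3)]
      · rw [hw2, hinter w hw]
        rw [hinter w hw] at hw2
        have := (inv_colorMult_le_of_card_eq_two hC hδ hK hw hw2).2
        push_cast
        linarith
    have htotal := sum_le_sum hvert
    rw [sum_add_distrib, ← mul_sum, ← card_eq_sum_inv_colorMult K T
      (fun c hc => mem_biUnion.1 (mem_sdiff.1 hc).1), sum_const, nsmul_eq_mul] at htotal
    have hdem := sum_le_sum hcharge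
    have hbig' : (δ : ℚ) + 1 ≤ #K := by exact_mod_cast hbig
    have hhalf : (#K : ℚ) ≤ 2 * (#K / 2 : ℕ) + 1 := by
      exact_mod_cast (by omega : #K ≤ 2 * (#K / 2) + 1)
    nlinarith [mul_le_mul_of_nonneg_left hhalf (by linarith : (0 : ℚ) ≤ δ + 1)]

/-- A barrier `S` together with a partition of its complement into parts without edges between
them bounds the number of colors. -/
lemma card_colors_le_of_partition (hC : IsEdge2Coloring G C) (hδ3 : 3 ≤ δ)
    (hδ : ∀ v, δ ≤ #{w | G.Adj v w}) {ι : Type*} [Fintype ι] (S : Finset V) (part : V → ι)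
    (hpart : ∀ v ∉ S, ∀ w ∉ S, G.Adj v w → part v = part w) :
    ((δ : ℚ) - 1) * numColors G C ≤
      Fintype.card V + (δ + 1) * (#S + ∑ i, #{v ∈ Sᶜ | part v = i} / 2 : ℕ) := by
  have hδ3' : (3 : ℚ) ≤ δ := by exact_mod_cast hδ3
  set K : ι → Finset V := fun i => {v ∈ Sᶜ | part v = i} with hKdef
  have hK : ∀ i, ∀ w ∈ K i, ∀ v, G.Adj w v → v ∈ S ∨ v ∈ K i := by
    intro i w hw v hv
    rw [or_iff_not_imp_left]
    intro hvS
    simp only [hKdef, mem_filter, mem_compl] at hw ⊢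
    exact ⟨hvS, by rw [← hpart w hw.1 v hvS hv, hw.2]⟩
  have hcover : univ.biUnion (colorsAt G C) ⊆ S.biUnion (colorsAt G C) ∪
      univ.biUnion fun i => (K i).biUnion (colorsAt G C) \ S.biUnion (colorsAt G C) := by
    intro c hc
    obtain ⟨v, -, hv⟩ := mem_biUnion.1 hc
    by_cases hcS : c ∈ S.biUnion (colorsAt G C)
    · exact mem_union_left _ hcS
    · have hvS : v ∉ S := fun h => hcS (mem_biUnion.2 ⟨v, h, hv⟩)
      exact mem_union_right _ (mem_biUnion.2 ⟨part v, mem_univ _, mem_sdiff.2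
        ⟨mem_biUnion.2 ⟨v, by simp [hKdef, hvS], hv⟩, hcS⟩⟩)
  have hcard : (numColors G C : ℚ) ≤ #(S.biUnion (colorsAt G C)) +
      ∑ i, (#((K i).biUnion (colorsAt G C) \ S.biUnion (colorsAt G C)) : ℚ) := by
    rw [numColors_eq_card_biUnion]
    exact_mod_cast (card_le_card hcover).trans
      ((card_union_le _ _).trans (Nat.add_le_add_left card_biUnion_le _))
  have hS := card_colors_of_finset_le hC hδ3 hδ S
  rw [← sum_fiberwise Sᶜ part] at hS
  have hparts := sum_le_sum fun i (_ : i ∈ univ) => card_colors_of_part_le hC hδ3 hδ (hK i)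
  simp only [sum_add_distrib, ← mul_sum] at hparts
  have hn : (Fintype.card V : ℚ) = #S + ∑ i, (#(K i) : ℚ) := by
    rw [← card_add_card_compl S,
      card_eq_sum_card_fiberwise (s := Sᶜ) (f := part) (t := univ) (by simp)]
    push_cast
    rfl
  have := mul_le_mul_of_nonneg_left hcard (by linarith : (0 : ℚ) ≤ δ - 1)
  push_cast
  linarith

end Coloring

section Berge

open Finset Classical

variable {V : Type*}

/-- The graph obtained from `G` by adding `d` vertices adjacent to all other vertices. -/
def addUniversal (G : SimpleGraph V) (d : ℕ) : SimpleGraph (V ⊕ Fin d) where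
  Adj x y := x ≠ y ∧ ∀ v w, x = Sum.inl v → y = Sum.inl w → G.Adj v w
  symm := ⟨fun _ _ h => ⟨h.1.symm, fun v w hv hw => (h.2 w v hw hv).symm⟩⟩
  loopless := ⟨fun _ h => h.1 rfl⟩

lemma addUniversal_adj_inl {G : SimpleGraph V} {d : ℕ} {v w : V} :
    (addUniversal G d).Adj (Sum.inl v) (Sum.inl w) ↔ G.Adj v w :=
  ⟨fun h => h.2 v w rfl rfl, fun h => ⟨fun e => h.ne (Sum.inl_injective e), by
    rintro _ _ ⟨⟩ ⟨⟩; exact h⟩⟩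

lemma addUniversal_adj_inr {G : SimpleGraph V} {d : ℕ} {j : Fin d} {x : V ⊕ Fin d}
    (h : x ≠ Sum.inr j) : (addUniversal G d).Adj x (Sum.inr j) :=
  ⟨h, by rintro _ _ _ ⟨⟩⟩

variable [Fintype V] {G : SimpleGraph V}

/-- A perfect matching of `G` with `d` universal vertices added leaves at most `d` vertices of `G`
uncovered. -/
lemma exists_isMatchingSet_of_isPerfectMatching {d : ℕ} {N : (addUniversal G d).Subgraph}
    (hN : N.IsPerfectMatching) :
    ∃ M : Set (Sym2 V), IsMatchingSet G M ∧ Fintype.card V ≤ 2 * M.ncard + d := by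
  rw [Subgraph.isPerfectMatching_iff] at hN
  have huniq : ∀ {x y z}, N.Adj x y → N.Adj x z → y = z := fun h h' => (hN _).unique h h'
  set H : SimpleGraph V := N.spanningCoe.comap Sum.inl
  have hHadj : ∀ {v w}, H.Adj v w ↔ N.Adj (Sum.inl v) (Sum.inl w) := Iff.rfl
  refine ⟨H.edgeSet, ⟨?_, ?_⟩, ?_⟩
  · exact edgeSet_mono fun v w h => addUniversal_adj_inl.1 (N.adj_sub h)
  · intro e he f hf hef v hve hvf
    obtain ⟨w, rfl⟩ := Sym2.mem_iff_exists.1 hve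
    obtain ⟨w', rfl⟩ := Sym2.mem_iff_exists.1 hvf
    exact hef (congrArg (fun x => s(v, x)) (Sum.inl_injective (huniq (hHadj.1 he) (hHadj.1 hf))))
  · choose p hp _ using hN
    have hcovered : #{v : V | ∃ w, H.Adj v w} ≤ 2 * H.edgeSet.ncard := by
      rw [← coe_edgeFinset, Set.ncard_coe_finset, mul_comm]
      refine (card_le_card (t := H.edgeFinset.biUnion Sym2.toFinset) ?_).trans
        (card_biUnion_le_card_mul _ _ _ fun e _ => ?_)
      · intro v hv
        obtain ⟨w, hw⟩ := (mem_filter.1 hv).2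
        exact mem_biUnion.2 ⟨s(v, w), mem_edgeFinset.2 hw, by simp⟩
      · rw [Sym2.card_toFinset]
        split_ifs <;> omega
    have huncovered : #{v : V | ¬ ∃ w, H.Adj v w} ≤ d := by
      have hj : ∀ v ∈ ({v : V | ¬ ∃ w, H.Adj v w} : Finset V),
          ∃ j, N.Adj (Sum.inl v) (Sum.inr j) := by
        intro v hv
        have h := hp (Sum.inl v)
        rcases hpv : p (Sum.inl v) with w | j
        · exact absurd ⟨w, hHadj.2 (hpv ▸ h)⟩ (mem_filter.1 hv).2
        · exact ⟨j, hpv ▸ h⟩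
      simpa only [card_univ, Fintype.card_fin] using! card_le_card_of_forall_subsingleton
        (t := (univ : Finset (Fin d)))
        (fun v j => N.Adj (Sum.inl v) (Sum.inr j))
        (fun v hv => by obtain ⟨j, h⟩ := hj v hv; exact ⟨j, mem_univ _, h⟩)
        fun j _ v hv w hw => Sum.inl_injective (huniq hv.2.symm hw.2.symm)
    have := card_filter_add_card_filter_not (s := (univ : Finset V)) fun v => ∃ w, H.Adj v w
    rw [card_univ] at this
    omega

/-- A Tutte violator of a graph with an even number of vertices contains all universal vertices. -/
lemma inr_mem_of_isTutteViolator {d : ℕ} (heven : Even (Nat.card (V ⊕ Fin d)))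
    {u : Set (V ⊕ Fin d)} (hu : (addUniversal G d).IsTutteViolator u) (j : Fin d) :
    Sum.inr j ∈ u := by
  by_contra hj
  rw [IsTutteViolator] at hu
  have hjv : Sum.inr j ∈ ((⊤ : (addUniversal G d).Subgraph).deleteVerts u).verts := by simp [hj]
  have hsub : Subsingleton
      ((⊤ : (addUniversal G d).Subgraph).deleteVerts u).coe.ConnectedComponent := by
    suffices h : ∀ c, c = connectedComponentMk
        ((⊤ : (addUniversal G d).Subgraph).deleteVerts u).coe ⟨Sum.inr j, hjv⟩ from
      ⟨fun a b => (h a).trans (h b).symm⟩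
    intro c
    induction c using ConnectedComponent.ind with
    | _ x =>
      rw [ConnectedComponent.eq]
      by_cases hx : x = ⟨Sum.inr j, hjv⟩
      · rw [hx]
      · have hx' : (x : V ⊕ Fin d) ≠ Sum.inr j := fun h => hx (Subtype.ext h)
        refine Adj.reachable ?_
        have hxu := x.2
        simp only [Subgraph.deleteVerts_verts, Subgraph.verts_top, Set.mem_sdiff] at hxu
        simp [hxu.2, hj, addUniversal_adj_inr hx']
  have hle := Set.ncard_le_one_of_subsingleton
    ((⊤ : (addUniversal G d).Subgraph).deleteVerts u).coe.oddComponents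
  have hu0 : u = ∅ := (Set.ncard_eq_zero).1 (by omega)
  have hodd : Odd ((⊤ : (addUniversal G d).Subgraph).deleteVerts u).coe.oddComponents.ncard := by
    rw [show ((⊤ : (addUniversal G d).Subgraph).deleteVerts u).coe.oddComponents.ncard = 1 by omega]
    exact odd_one
  rw [odd_ncard_oddComponents] at hodd
  subst hu0
  have hcard : Nat.card ((⊤ : (addUniversal G d).Subgraph).deleteVerts ∅).verts =
      Nat.card (V ⊕ Fin d) := by
    simp [Set.ncard_univ]
  rw [hcard] at hodd
  exact Nat.not_odd_iff_even.2 heven hodd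

/-- The inequality of the Tutte–Berge formula that provides a barrier: if all matchings have at
most `m` edges, there are a set `S` and a partition of its complement into parts without edges
between them such that `|S| + ∑ ⌊|K| / 2⌋ ≤ m`, where `K` ranges over the parts. -/
lemma exists_barrier.{u} {V : Type u} [Fintype V] (G : SimpleGraph V) (m : ℕ)
    (hm : ∀ M : Set (Sym2 V), IsMatchingSet G M → M.ncard ≤ m) :
    ∃ (ι : Type u) (_ : Fintype ι) (S : Finset V) (part : V → ι),
      (∀ v ∉ S, ∀ w ∉ S, G.Adj v w → part v = part w) ∧
      #S + ∑ i, #{v ∈ Sᶜ | part v = i} / 2 ≤ m := by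
  rcases Nat.lt_or_ge (Fintype.card V) (2 * m + 2) with hlt | hge
  · refine ⟨PUnit, inferInstance, ∅, fun _ => PUnit.unit, fun _ _ _ _ _ => rfl, ?_⟩
    simp
    omega
  obtain ⟨d, hd⟩ := Nat.exists_eq_add_of_le hge
  have hno : ¬ ∃ N : (addUniversal G d).Subgraph, N.IsPerfectMatching := by
    rintro ⟨N, hN⟩
    obtain ⟨M, hM, hcard⟩ := exists_isMatchingSet_of_isPerfectMatching hN
    have := hm M hM
    omega
  rw [tutte] at hno
  push Not at hno
  obtain ⟨u, hu⟩ := hno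
  have heven : Even (Nat.card (V ⊕ Fin d)) := by
    rw [Nat.card_sum, Nat.card_eq_fintype_card, Nat.card_eq_fintype_card, Fintype.card_fin, hd]
    exact ⟨m + 1 + d, by ring⟩
  have huniv := inr_mem_of_isTutteViolator heven hu
  rw [IsTutteViolator] at hu
  set D := ((⊤ : (addUniversal G d).Subgraph).deleteVerts u).coe with hD
  have hverts : ∀ x, x ∈ ((⊤ : (addUniversal G d).Subgraph).deleteVerts u).verts ↔ x ∉ u := by
    simp
  set S : Finset V := {v | Sum.inl v ∈ u} with hS
  have hmemS : ∀ v, v ∈ S ↔ Sum.inl v ∈ u := by simp [hS]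
  set part : V → Option D.ConnectedComponent := fun v =>
    if h : Sum.inl v ∈ u then none
    else some (D.connectedComponentMk ⟨Sum.inl v, (hverts _).2 h⟩) with hpart
  refine ⟨Option D.ConnectedComponent, inferInstance, S, part, ?_, ?_⟩
  · intro v hv w hw hvw
    rw [hmemS] at hv hw
    simp only [hpart, hv, hw, dite_false, Option.some_inj, ConnectedComponent.eq]
    refine Adj.reachable ?_
    simp [hD, hv, hw, addUniversal_adj_inl, hvw]
  · have hcardu : u.ncard = #S + d := by
      have : u = ((S.disjSum univ : Finset (V ⊕ Fin d)) : Set (V ⊕ Fin d)) := by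
        ext x
        rcases x with v | j
        · simp [hmemS]
        · simp [huniv j]
      rw [this, Set.ncard_coe_finset, card_disjSum, card_univ, Fintype.card_fin]
    have hsupp : ∀ c : D.ConnectedComponent, #{v ∈ Sᶜ | part v = some c} = c.supp.ncard := by
      intro c
      rw [← Set.ncard_coe_finset]
      refine Set.ncard_congr (fun v hv => ⟨Sum.inl v, (hverts _).2 ?_⟩) ?_ ?_ ?_
      · simpa [hmemS] using (mem_filter.1 hv).1
      · intro v hv
        have h1 : Sum.inl v ∉ u := by simpa [hmemS] using (mem_filter.1 hv).1
        have h2 := (mem_filter.1 hv).2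
        simpa [hpart, h1] using h2
      · intro v w _ _ h
        exact Sum.inl_injective (congrArg Subtype.val h)
      · rintro ⟨x, hx⟩ hxc
        have hxu := (hverts x).1 hx
        rcases x with v | j
        · refine ⟨v, ?_, rfl⟩
          rw [mem_coe, mem_filter, mem_compl, hmemS]
          refine ⟨hxu, ?_⟩
          simpa [hpart, hxu] using hxc
        · exact absurd (huniv j) hxu
    have hnone : #{v ∈ Sᶜ | part v = none} = 0 := by
      rw [card_eq_zero, filter_eq_empty_iff]
      intro v hv
      rw [mem_compl, hmemS] at hv
      simp [hpart, hv]
    have hodd : ∑ i, #{v ∈ Sᶜ | part v = i} % 2 = D.oddComponents.ncard := by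
      rw [Fintype.sum_option, hnone, Nat.zero_mod, zero_add, Set.ncard_eq_toFinset_card',
        Set.toFinset_ofPred, card_filter]
      refine sum_congr rfl fun c _ => ?_
      rw [hsupp]
      split_ifs with h
      · exact Nat.odd_iff.1 h
      · exact Nat.even_iff.1 (Nat.not_odd_iff_even.1 h)
    have htotal : #S + ∑ i, #{v ∈ Sᶜ | part v = i} = Fintype.card V := by
      rw [← card_add_card_compl S,
        card_eq_sum_card_fiberwise (s := Sᶜ) (f := part) (t := univ) (by simp)]
    have hdiv : ∑ i, #{v ∈ Sᶜ | part v = i} =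
        2 * ∑ i, #{v ∈ Sᶜ | part v = i} / 2 + ∑ i, #{v ∈ Sᶜ | part v = i} % 2 := by
      rw [mul_sum, ← sum_add_distrib]
      exact sum_congr rfl fun i _ => (Nat.div_add_mod _ _).symm
    have hfinal : #S + ∑ i, #{v ∈ Sᶜ | part v = i} / 2 ≤ m := by omega
    convert hfinal

end Berge

/-- For a connected graph with minimum degree `δ ≥ 3` and maximum matching `M`, every edge
2-coloring uses at most `|M| + (n + 2|M|)/(δ − 1)` colors: `(c − |M|)·(δ − 1) ≤ n + 2|M|`. -/
theorem numColors_le_matching_bound {V : Type*} [Fintype V] (G : SimpleGraph V)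
    (hconn : G.Connected) (δ : ℕ)
    (hδ3 : 3 ≤ δ) (hδ : ∀ v : V, δ ≤ (G.neighborSet v).ncard)
    (M : Set (Sym2 V)) (hM : IsMatchingSet G M)
    (hmax : ∀ M' : Set (Sym2 V), IsMatchingSet G M' → M'.ncard ≤ M.ncard)
    (C : Sym2 V → ℕ) (hC : IsEdge2Coloring G C) :
    ((numColors G C : ℤ) - (M.ncard : ℤ)) * ((δ : ℤ) - 1) ≤
      (Fintype.card V : ℤ) + 2 * (M.ncard : ℤ) := by
  classical
  have hdeg : ∀ v, δ ≤ Finset.card {w | G.Adj v w} := fun v => by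
    refine (hδ v).trans_eq ?_
    rw [← Set.ncard_coe_finset]
    congr 1
    ext w
    simp
  obtain ⟨ι, _, S, part, hpart, hle⟩ := exists_barrier G M.ncard hmax
  have h := card_colors_le_of_partition hC hδ3 (fun v => by convert hdeg v) S part hpart
  have hle' : (S.card + ∑ i, Finset.card {v ∈ Sᶜ | part v = i} / 2 : ℕ) ≤ (M.ncard : ℚ) := by
    exact_mod_cast hle
  have hmul := mul_le_mul_of_nonneg_left hle' (by positivity : (0 : ℚ) ≤ δ + 1)
  have key : ((numColors G C : ℚ) - M.ncard) * (δ - 1) ≤ Fintype.card V + 2 * M.ncard := by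
    linarith
  exact_mod_cast key
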